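/- For the curvature Lagrangian L(x₀,x₁,x₂) = α√δ₂/δ₁, the Euler–Lagrange expression contracted with the momentum p̂¹ reproduces the primary Lagrangian constraint: ⟨[L], p̂¹⟩ + (p̂⁰ p̂⁰) = 0 identically for all (x₀,x₁,x₂,x₃,x₄) with δ₁ > 0 and δ₂ > 0 (equivalently, ⟨[L], p̂¹⟩ = −α² δ₃/δ₂²). -/

import Mathlib

open scoped BigOperators Matrix

noncomputable section

/-- `V d` is `ℝ^d`. -/
abbrev V (d : ℕ) := Fin d → ℝ

variable {d : ℕ}

/-- The bilinear form determined by the symmetric matrix `B`: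
`(u v) = B(u,v) = uᵀ B v`. -/
def bf (B : Matrix (Fin d) (Fin d) ℝ) (u v : V d) : ℝ := u ⬝ᵥ B *ᵥ v

/-- The Gram determinant of a family of vectors with respect to `B`. -/
def gram (B : Matrix (Fin d) (Fin d) ℝ) {m : ℕ} (x : Fin m → V d) : ℝ :=
  (Matrix.of fun i j => bf B (x i) (x j)).det

/-- `δ₁ = (x₁ x₁)` as a `1×1` Gram determinant. -/
def d1 (B : Matrix (Fin d) (Fin d) ℝ) (x1 : V d) : ℝ := gram B ![x1]

/-- `δ₂`, the Gram determinant of `x₁, x₂`. -/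
def d2 (B : Matrix (Fin d) (Fin d) ℝ) (x1 x2 : V d) : ℝ := gram B ![x1, x2]

/-- `δ₃`, the Gram determinant of `x₁, x₂, x₃`. -/
def d3 (B : Matrix (Fin d) (Fin d) ℝ) (x1 x2 x3 : V d) : ℝ := gram B ![x1, x2, x3]

/-- The orthogonalized vector `ξ₂ = x₂ − ((x₂ ξ₁)/(ξ₁ ξ₁)) ξ₁` (with `ξ₁ = x₁`). -/
def xi2 (B : Matrix (Fin d) (Fin d) ℝ) (x1 x2 : V d) : V d :=
  x2 - (bf B x2 x1 / bf B x1 x1) • x1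

/-- The orthogonalized vector
`ξ₃ = x₃ − ((x₃ ξ₂)/(ξ₂ ξ₂)) ξ₂ − ((x₃ ξ₁)/(ξ₁ ξ₁)) ξ₁`. -/
def xi3 (B : Matrix (Fin d) (Fin d) ℝ) (x1 x2 x3 : V d) : V d :=
  x3 - (bf B x3 (xi2 B x1 x2) / bf B (xi2 B x1 x2) (xi2 B x1 x2)) • xi2 B x1 x2
     - (bf B x3 x1 / bf B x1 x1) • x1

/-- The curvature Lagrangian `L(x₀,x₁,x₂) = α √δ₂ / δ₁` of the relativistic
particle (independent of `x₀`). -/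
def Lc (B : Matrix (Fin d) (Fin d) ℝ) (α : ℝ) (x : V d × V d × V d) : ℝ :=
  α * Real.sqrt (d2 B x.2.1 x.2.2) / d1 B x.2.1

/-- The Ostrogradskii momentum `p̂¹`, identified with a vector via `B`:
the (for nondegenerate symmetric `B`, unique) vector with
`B(p̂¹,v) = (∂L/∂x₂)[v]` for all `v`. -/
def p1h (B : Matrix (Fin d) (Fin d) ℝ) (α : ℝ) (x0 x1 x2 : V d) : V d :=
  B⁻¹ *ᵥ fun a => fderiv ℝ (Lc B α) (x0, x1, x2) (0, 0, Pi.single a 1)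

/-- The Ostrogradskii momentum `p̂⁰`, identified with a vector via `B`:
the vector with `B(p̂⁰,v) = (∂L/∂x₁)[v] − (D_t B(p̂¹,·))[v]` for all `v`. -/
def p0h (B : Matrix (Fin d) (Fin d) ℝ) (α : ℝ) (x0 x1 x2 x3 : V d) : V d :=
  B⁻¹ *ᵥ fun a =>
    fderiv ℝ (Lc B α) (x0, x1, x2) (0, Pi.single a 1, 0) -
      fderiv ℝ (fun y : V d × V d × V d =>
          bf B (p1h B α y.1 y.2.1 y.2.2) (Pi.single a 1))
        (x0, x1, x2) (x1, x2, x3)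

/-- The Euler–Lagrange expression `[L] = ∂L/∂x₀ − D_t(B(p̂⁰,·))` as a covector,
evaluated on the vector `v`. -/
def ELc (B : Matrix (Fin d) (Fin d) ℝ) (α : ℝ) (x0 x1 x2 x3 x4 : V d) (v : V d) : ℝ :=
  fderiv ℝ (Lc B α) (x0, x1, x2) (v, 0, 0) -
    fderiv ℝ (fun y : V d × V d × V d × V d =>
        bf B (p0h B α y.1 y.2.1 y.2.2.1 y.2.2.2) v)
      (x0, x1, x2, x3) (x1, x2, x3, x4)

/-- The formal total time derivative of a time-dependent function
`f(t,x₀,x₁,x₂,x₃)`, a function of `(t,x₀,…,x₄)`. -/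
def DtT (f : ℝ × (V d × V d × V d × V d) → ℝ)
    (t : ℝ) (x0 x1 x2 x3 x4 : V d) : ℝ :=
  fderiv ℝ f (t, (x0, x1, x2, x3)) (1, (x1, x2, x3, x4))

theorem bf_comm (B : Matrix (Fin d) (Fin d) ℝ) (hB : B.IsSymm) (u v : V d) :
    bf B u v = bf B v u := by
  unfold bf
  rw [Matrix.dotProduct_mulVec, ← Matrix.mulVec_transpose, hB.eq, dotProduct_comm]

@[simp] theorem bf_add_left (B : Matrix (Fin d) (Fin d) ℝ) (u v w : V d) :
    bf B (u + v) w = bf B u w + bf B v w := by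
  simp [bf, add_dotProduct]

@[simp] theorem bf_sub_left (B : Matrix (Fin d) (Fin d) ℝ) (u v w : V d) :
    bf B (u - v) w = bf B u w - bf B v w := by
  simp [bf, sub_dotProduct]

@[simp] theorem bf_smul_left (B : Matrix (Fin d) (Fin d) ℝ) (r : ℝ) (u w : V d) :
    bf B (r • u) w = r * bf B u w := by
  simp [bf]

@[simp] theorem bf_add_right (B : Matrix (Fin d) (Fin d) ℝ) (u v w : V d) :
    bf B u (v + w) = bf B u v + bf B u w := by
  simp [bf, Matrix.mulVec_add, dotProduct_add]

@[simp] theorem bf_sub_right (B : Matrix (Fin d) (Fin d) ℝ) (u v w : V d) :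
    bf B u (v - w) = bf B u v - bf B u w := by
  simp [bf, Matrix.mulVec_sub, dotProduct_sub]

@[simp] theorem bf_smul_right (B : Matrix (Fin d) (Fin d) ℝ) (r : ℝ) (u w : V d) :
    bf B u (r • w) = r * bf B u w := by
  simp [bf, Matrix.mulVec_smul]

@[simp] theorem bf_zero_left (B : Matrix (Fin d) (Fin d) ℝ) (u : V d) : bf B 0 u = 0 := by
  simp [bf]

@[simp] theorem bf_zero_right (B : Matrix (Fin d) (Fin d) ℝ) (u : V d) : bf B u 0 = 0 := by
  simp [bf]

theorem inv_mulVec_bf_single (B : Matrix (Fin d) (Fin d) ℝ) (hB : B.IsSymm)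
    (hdet : IsUnit B.det) (p : V d) :
    (B⁻¹ *ᵥ fun a => bf B p (Pi.single a 1)) = p := by
  have h : (fun a => bf B p (Pi.single a 1)) = B *ᵥ p := by
    ext a
    rw [bf_comm B hB]
    simp [bf]
  rw [h, Matrix.mulVec_mulVec, Matrix.nonsing_inv_mul B hdet, Matrix.one_mulVec]

theorem d1_eq (B : Matrix (Fin d) (Fin d) ℝ) (x : V d) : d1 B x = bf B x x := by
  simp [d1, gram]

theorem d2_eq (B : Matrix (Fin d) (Fin d) ℝ) (hB : B.IsSymm) (x y : V d) :
    d2 B x y = bf B x x * bf B y y - bf B x y ^ 2 := by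
  simp [d2, gram, Matrix.det_fin_two, bf_comm B hB y x]
  ring

theorem d3_eq (B : Matrix (Fin d) (Fin d) ℝ) (hB : B.IsSymm) (x y z : V d) :
    d3 B x y z = bf B x x * bf B y y * bf B z z + 2 * bf B x y * bf B y z * bf B x z
      - bf B x x * bf B y z ^ 2 - bf B y y * bf B x z ^ 2 - bf B z z * bf B x y ^ 2 := by
  simp [d3, gram, Matrix.det_fin_three, bf_comm B hB y x, bf_comm B hB z x, bf_comm B hB z y]
  ring

theorem hasDerivAt_bf {B : Matrix (Fin d) (Fin d) ℝ} {u v : ℝ → V d} {u' v' : V d} {t : ℝ}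
    (hu : HasDerivAt u u' t) (hv : HasDerivAt v v' t) :
    HasDerivAt (fun s => bf B (u s) (v s)) (bf B u' (v t) + bf B (u t) v') t := by
  unfold bf Matrix.mulVec dotProduct
  rw [← Finset.sum_add_distrib]
  refine HasDerivAt.fun_sum fun i _ => ?_
  exact (hasDerivAt_pi.1 hu i).fun_mul
    (HasDerivAt.fun_sum fun j _ => (hasDerivAt_pi.1 hv j).const_mul (B i j))

@[fun_prop] theorem differentiableAt_bf {E : Type*} [NormedAddCommGroup E] [NormedSpace ℝ E]
    {B : Matrix (Fin d) (Fin d) ℝ} {u v : E → V d} {x : E}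
    (hu : DifferentiableAt ℝ u x) (hv : DifferentiableAt ℝ v x) :
    DifferentiableAt ℝ (fun y => bf B (u y) (v y)) x := by
  unfold bf Matrix.mulVec dotProduct
  fun_prop

/-- The explicit form `α ξ₂ / √δ₂` of the momentum `p̂¹`. -/
def momentumOne (B : Matrix (Fin d) (Fin d) ℝ) (α : ℝ) (x y : V d) : V d :=
  (α / Real.sqrt (d2 B x y)) • (y - (bf B x y / bf B x x) • x)

/-- The explicit form `-α ξ₃ / √δ₂` of the momentum `p̂⁰`. -/
def momentumZero (B : Matrix (Fin d) (Fin d) ℝ) (α : ℝ) (x y z : V d) : V d :=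
  (-α / Real.sqrt (d2 B x y)) •
    (z - ((bf B x x * bf B y z - bf B x y * bf B x z) / d2 B x y) • y
      - ((bf B y y * bf B x z - bf B x y * bf B y z) / d2 B x y) • x)

theorem differentiableAt_d2 {E : Type*} [NormedAddCommGroup E] [NormedSpace ℝ E]
    {B : Matrix (Fin d) (Fin d) ℝ} (hB : B.IsSymm) {u v : E → V d} {x : E}
    (hu : DifferentiableAt ℝ u x) (hv : DifferentiableAt ℝ v x) :
    DifferentiableAt ℝ (fun y => d2 B (u y) (v y)) x := by
  simp only [d2_eq B hB]
  fun_prop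

theorem differentiableAt_momentumOne {E : Type*} [NormedAddCommGroup E] [NormedSpace ℝ E]
    {B : Matrix (Fin d) (Fin d) ℝ} (hB : B.IsSymm) (α : ℝ) {u v : E → V d} {x : E}
    (hu : DifferentiableAt ℝ u x) (hv : DifferentiableAt ℝ v x)
    (h1 : 0 < d1 B (u x)) (h2 : 0 < d2 B (u x) (v x)) :
    DifferentiableAt ℝ (fun y => momentumOne B α (u y) (v y)) x := by
  have hd := differentiableAt_d2 hB hu hv
  rw [d1_eq] at h1
  have hs := (Real.sqrt_pos.2 h2).ne'
  have hsd : DifferentiableAt ℝ (fun y => Real.sqrt (d2 B (u y) (v y))) x := hd.sqrt h2.ne'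
  unfold momentumOne
  fun_prop (disch := first | exact hs | exact h1.ne')

theorem differentiableAt_momentumZero {E : Type*} [NormedAddCommGroup E] [NormedSpace ℝ E]
    {B : Matrix (Fin d) (Fin d) ℝ} (hB : B.IsSymm) (α : ℝ) {u v w : E → V d} {x : E}
    (hu : DifferentiableAt ℝ u x) (hv : DifferentiableAt ℝ v x) (hw : DifferentiableAt ℝ w x)
    (h2 : 0 < d2 B (u x) (v x)) :
    DifferentiableAt ℝ (fun y => momentumZero B α (u y) (v y) (w y)) x := by
  have hd := differentiableAt_d2 hB hu hv
  have hs := (Real.sqrt_pos.2 h2).ne'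
  have hsd : DifferentiableAt ℝ (fun y => Real.sqrt (d2 B (u y) (v y))) x := hd.sqrt h2.ne'
  unfold momentumZero
  fun_prop (disch := first | exact hs | exact h2.ne')

theorem differentiableAt_Lc {B : Matrix (Fin d) (Fin d) ℝ} (hB : B.IsSymm) (α : ℝ)
    {x : V d × V d × V d} (h1 : 0 < d1 B x.2.1) (h2 : 0 < d2 B x.2.1 x.2.2) :
    DifferentiableAt ℝ (Lc B α) x := by
  have hd : DifferentiableAt ℝ (fun y : V d × V d × V d => d2 B y.2.1 y.2.2) x :=
    differentiableAt_d2 hB (by fun_prop) (by fun_prop)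
  have hsd := hd.sqrt h2.ne'
  unfold Lc
  rw [d1_eq] at h1
  simp only [d1_eq]
  fun_prop (disch := exact h1.ne')

theorem fderiv_apply_eq_of_hasDerivAt_line {E F : Type*} [NormedAddCommGroup E]
    [NormedSpace ℝ E] [NormedAddCommGroup F] [NormedSpace ℝ F] {f : E → F} {x v : E} {m : F}
    (hf : DifferentiableAt ℝ f x) (h : HasDerivAt (fun t : ℝ => f (x + t • v)) m 0) :
    fderiv ℝ f x v = m := by
  rw [← hf.lineDeriv_eq_fderiv]
  exact HasLineDerivAt.lineDeriv h

theorem hasDerivAt_line {E : Type*} [NormedAddCommGroup E] [NormedSpace ℝ E] (x v : E) :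
    HasDerivAt (fun t : ℝ => x + t • v) v 0 := by
  simpa using ((hasDerivAt_id (0 : ℝ)).smul_const v).const_add x

theorem hasDerivAt_d2 {B : Matrix (Fin d) (Fin d) ℝ} (hB : B.IsSymm) {u v : ℝ → V d}
    {u' v' : V d} {t : ℝ} (hu : HasDerivAt u u' t) (hv : HasDerivAt v v' t) :
    HasDerivAt (fun s => d2 B (u s) (v s))
      (2 * (bf B (v t) (v t) * bf B (u t) u' + bf B (u t) (u t) * bf B (v t) v'
        - bf B (u t) (v t) * (bf B (v t) u' + bf B (u t) v'))) t := by
  simp only [d2_eq B hB]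
  have key := ((hasDerivAt_bf (B := B) hu hu).fun_mul (hasDerivAt_bf (B := B) hv hv)).fun_sub
    ((hasDerivAt_bf (B := B) hu hv).fun_pow 2)
  refine key.congr_deriv ?_
  rw [bf_comm B hB u' (u t), bf_comm B hB v' (v t), bf_comm B hB u' (v t)]
  ring

/-- The differential of the curvature Lagrangian. -/
theorem fderiv_Lc {B : Matrix (Fin d) (Fin d) ℝ} (hB : B.IsSymm) (α : ℝ)
    {x y z : V d} (h1 : 0 < d1 B y) (h2 : 0 < d2 B y z) (p q r : V d) :
    fderiv ℝ (Lc B α) (x, y, z) (p, q, r) =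
      α * (bf B z z * bf B y q + bf B y y * bf B z r - bf B y z * (bf B z q + bf B y r))
          / (bf B y y * Real.sqrt (d2 B y z))
        - 2 * α * Real.sqrt (d2 B y z) * bf B y q / bf B y y ^ 2 := by
  have hs := Real.sqrt_pos.2 h2
  have h2' : d2 B (y + (0 : ℝ) • q) (z + (0 : ℝ) • r) ≠ 0 := by simpa using h2.ne'
  have h1' : bf B (y + (0 : ℝ) • q) (y + (0 : ℝ) • q) ≠ 0 := by
    simpa [d1_eq] using h1.ne'
  have hy := hasDerivAt_line y q
  have hz := hasDerivAt_line z r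
  have key := (((hasDerivAt_d2 hB hy hz).sqrt h2').const_mul α).fun_div
    (hasDerivAt_bf (B := B) hy hy) h1'
  refine fderiv_apply_eq_of_hasDerivAt_line (differentiableAt_Lc hB α h1 h2) ?_
  have hline : (fun t : ℝ => Lc B α ((x, y, z) + t • (p, q, r))) = fun t : ℝ =>
      α * Real.sqrt (d2 B (y + t • q) (z + t • r)) / bf B (y + t • q) (y + t • q) := by
    ext t
    simp only [Lc, d1_eq, Prod.smul_mk, Prod.mk_add_mk]
  rw [hline]
  refine key.congr_deriv ?_
  rw [d1_eq] at h1
  simp only [zero_smul, add_zero, bf_comm B hB q y]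
  generalize Real.sqrt (d2 B y z) = s at hs ⊢
  field_simp
  ring

theorem p1h_eq {B : Matrix (Fin d) (Fin d) ℝ} (hB : B.IsSymm) (hdet : IsUnit B.det) (α : ℝ)
    {x y z : V d} (h1 : 0 < d1 B y) (h2 : 0 < d2 B y z) :
    p1h B α x y z = momentumOne B α y z := by
  rw [← inv_mulVec_bf_single B hB hdet (momentumOne B α y z)]
  unfold p1h
  congr 1
  ext a
  rw [fderiv_Lc hB α h1 h2]
  have hs := Real.sqrt_pos.2 h2
  rw [d1_eq] at h1
  simp only [momentumOne, bf_smul_left, bf_sub_left, bf_zero_right]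
  field_simp
  ring

theorem hasDerivAt_momentumOne {B : Matrix (Fin d) (Fin d) ℝ} (hB : B.IsSymm) (α : ℝ)
    {x y z : V d} (h1 : 0 < d1 B x) (h2 : 0 < d2 B x y) :
    HasDerivAt (fun t : ℝ => momentumOne B α (x + t • y) (y + t • z))
      ((α / Real.sqrt (d2 B x y)) • (z - (bf B x y / bf B x x) • y
          - ((bf B y y + bf B x z) / bf B x x - 2 * bf B x y ^ 2 / bf B x x ^ 2) • x)
        - (α * (bf B x x * bf B y z - bf B x y * bf B x z)
            / (d2 B x y * Real.sqrt (d2 B x y))) • (y - (bf B x y / bf B x x) • x)) 0 := by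
  have hs := Real.sqrt_pos.2 h2
  have hss := Real.sq_sqrt h2.le
  have h2' : d2 B (x + (0 : ℝ) • y) (y + (0 : ℝ) • z) ≠ 0 := by simpa using h2.ne'
  have hs' : Real.sqrt (d2 B (x + (0 : ℝ) • y) (y + (0 : ℝ) • z)) ≠ 0 := by simpa using hs.ne'
  have h1' : bf B (x + (0 : ℝ) • y) (x + (0 : ℝ) • y) ≠ 0 := by
    simpa [d1_eq] using h1.ne'
  have hx := hasDerivAt_line x y
  have hy := hasDerivAt_line y z
  have key := (((hasDerivAt_const (0 : ℝ) α).fun_div ((hasDerivAt_d2 hB hx hy).sqrt h2') hs')).fun_smul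
    (hy.fun_sub
      (((hasDerivAt_bf (B := B) hx hy).fun_div (hasDerivAt_bf (B := B) hx hx) h1').fun_smul hx))
  unfold momentumOne
  refine key.congr_deriv ?_
  rw [d1_eq] at h1
  simp only [zero_smul, add_zero, bf_comm B hB y x, hss]
  ext i
  simp only [Pi.add_apply, Pi.sub_apply, Pi.smul_apply, smul_eq_mul]
  field_simp
  ring

theorem p0h_eq {B : Matrix (Fin d) (Fin d) ℝ} (hB : B.IsSymm) (hdet : IsUnit B.det) (α : ℝ)
    {w x y z : V d} (h1 : 0 < d1 B x) (h2 : 0 < d2 B x y) :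
    p0h B α w x y z = momentumZero B α x y z := by
  rw [← inv_mulVec_bf_single B hB hdet (momentumZero B α x y z)]
  unfold p0h
  congr 1
  ext a
  have hev : (fun q : V d × V d × V d => bf B (p1h B α q.1 q.2.1 q.2.2) (Pi.single a 1))
      =ᶠ[nhds (w, x, y)] fun q => bf B (momentumOne B α q.2.1 q.2.2) (Pi.single a 1) := by
    have c2 : ContinuousAt (fun q : V d × V d × V d => d2 B q.2.1 q.2.2) (w, x, y) :=
      (differentiableAt_d2 hB (by fun_prop) (by fun_prop)).continuousAt
    have c1 : ContinuousAt (fun q : V d × V d × V d => d1 B q.2.1) (w, x, y) := by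
      simp only [d1_eq]
      exact DifferentiableAt.continuousAt (𝕜 := ℝ) (by fun_prop)
    filter_upwards [c1.eventually (lt_mem_nhds h1), c2.eventually (lt_mem_nhds h2)] with q k1 k2
    rw [p1h_eq hB hdet α k1 k2]
  have hD : fderiv ℝ (fun q : V d × V d × V d =>
      bf B (momentumOne B α q.2.1 q.2.2) (Pi.single a 1)) (w, x, y) (x, y, z) = _ :=
    fderiv_apply_eq_of_hasDerivAt_line
      (differentiableAt_bf (differentiableAt_momentumOne hB α (by fun_prop) (by fun_prop) h1 h2)
        (by fun_prop))
      (hasDerivAt_bf (hasDerivAt_momentumOne hB α h1 h2) (hasDerivAt_const _ _))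
  rw [hev.fderiv_eq, hD, fderiv_Lc hB α h1 h2]
  have hs := Real.sqrt_pos.2 h2
  have hss := Real.sq_sqrt h2.le
  have he := d2_eq B hB x y
  rw [d1_eq] at h1
  simp only [momentumZero, bf_smul_left, bf_sub_left, bf_zero_right]
  set s := Real.sqrt (d2 B x y)
  have hc : bf B y y = (s ^ 2 + bf B x y ^ 2) / bf B x x := by
    rw [hss, he]; field_simp; ring
  rw [← hss, hc]
  field_simp
  ring

theorem bf_momentumZero_left {B : Matrix (Fin d) (Fin d) ℝ} (hB : B.IsSymm) (α : ℝ)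
    {x y : V d} (z : V d) (h2 : 0 < d2 B x y) : bf B (momentumZero B α x y z) x = 0 := by
  simp only [momentumZero, bf_smul_left, bf_sub_left, bf_comm B hB y x, bf_comm B hB z x]
  have he := d2_eq B hB x y
  rw [mul_eq_zero]
  right
  field_simp
  rw [he]
  ring

theorem bf_momentumZero_mid {B : Matrix (Fin d) (Fin d) ℝ} (hB : B.IsSymm) (α : ℝ)
    {x y : V d} (z : V d) (h2 : 0 < d2 B x y) : bf B (momentumZero B α x y z) y = 0 := by
  simp only [momentumZero, bf_smul_left, bf_sub_left, bf_comm B hB z y]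
  have he := d2_eq B hB x y
  rw [mul_eq_zero]
  right
  field_simp
  rw [he]
  ring

theorem bf_momentumZero_right {B : Matrix (Fin d) (Fin d) ℝ} (hB : B.IsSymm) (α : ℝ)
    {x y : V d} (z : V d) (h2 : 0 < d2 B x y) :
    bf B (momentumZero B α x y z) z
      = -α / Real.sqrt (d2 B x y) * (d3 B x y z / d2 B x y) := by
  simp only [momentumZero, bf_smul_left, bf_sub_left]
  have he := d2_eq B hB x y
  congr 1
  rw [d3_eq B hB]
  field_simp
  rw [he]
  ring

theorem bf_momentumZero_self {B : Matrix (Fin d) (Fin d) ℝ} (hB : B.IsSymm) (α : ℝ)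
    {x y : V d} (z : V d) (h2 : 0 < d2 B x y) :
    bf B (momentumZero B α x y z) (momentumZero B α x y z)
      = α ^ 2 * d3 B x y z / d2 B x y ^ 2 := by
  have hs := Real.sqrt_pos.2 h2
  have hss := Real.sq_sqrt h2.le
  conv_lhs => arg 3; unfold momentumZero
  simp only [bf_smul_right, bf_sub_right, bf_momentumZero_left hB α z h2,
    bf_momentumZero_mid hB α z h2, bf_momentumZero_right hB α z h2]
  set s := Real.sqrt (d2 B x y)
  rw [← hss]
  field_simp
  ring

theorem ELc_p1h {B : Matrix (Fin d) (Fin d) ℝ} (hB : B.IsSymm) (hdet : IsUnit B.det) (α : ℝ)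
    {x0 x1 x2 : V d} (x3 x4 : V d) (h1 : 0 < d1 B x1) (h2 : 0 < d2 B x1 x2) :
    ELc B α x0 x1 x2 x3 x4 (p1h B α x0 x1 x2) = -(α ^ 2 * d3 B x1 x2 x3 / d2 B x1 x2 ^ 2) := by
  rw [p1h_eq hB hdet α h1 h2]
  set v := momentumOne B α x1 x2 with hv
  have hev : (fun q : V d × V d × V d × V d => bf B (p0h B α q.1 q.2.1 q.2.2.1 q.2.2.2) v)
      =ᶠ[nhds (x0, x1, x2, x3)] fun q => bf B (momentumZero B α q.2.1 q.2.2.1 q.2.2.2) v := by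
    have c2 : ContinuousAt (fun q : V d × V d × V d × V d => d2 B q.2.1 q.2.2.1)
        (x0, x1, x2, x3) :=
      (differentiableAt_d2 hB (by fun_prop) (by fun_prop)).continuousAt
    have c1 : ContinuousAt (fun q : V d × V d × V d × V d => d1 B q.2.1) (x0, x1, x2, x3) := by
      simp only [d1_eq]
      exact DifferentiableAt.continuousAt (𝕜 := ℝ) (by fun_prop)
    filter_upwards [c1.eventually (lt_mem_nhds h1), c2.eventually (lt_mem_nhds h2)] with q k1 k2
    rw [p0h_eq hB hdet α k1 k2]
  have hx := hasDerivAt_line x1 x2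
  have hy := hasDerivAt_line x2 x3
  have hz := hasDerivAt_line x3 x4
  have hP0 := (differentiableAt_momentumZero hB α hx.differentiableAt hy.differentiableAt
    hz.differentiableAt (by simpa using h2)).hasDerivAt
  set P' := deriv (fun t : ℝ => momentumZero B α (x1 + t • x2) (x2 + t • x3) (x3 + t • x4)) 0
  have hD : fderiv ℝ (fun q : V d × V d × V d × V d =>
      bf B (momentumZero B α q.2.1 q.2.2.1 q.2.2.2) v) (x0, x1, x2, x3) (x1, x2, x3, x4) = _ :=
    fderiv_apply_eq_of_hasDerivAt_line
      (differentiableAt_bf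
        (differentiableAt_momentumZero hB α (by fun_prop) (by fun_prop) (by fun_prop) h2)
        (by fun_prop))
      (hasDerivAt_bf hP0 (hasDerivAt_const _ _))
  have horth := hasDerivAt_bf (B := B) hP0 (hasDerivAt_momentumOne hB α (z := x3) h1 h2)
  have hzero : (fun t : ℝ => bf B (momentumZero B α (x1 + t • x2) (x2 + t • x3) (x3 + t • x4))
      (momentumOne B α (x1 + t • x2) (x2 + t • x3))) =ᶠ[nhds 0] fun _ => 0 := by
    have c2 : ContinuousAt (fun t : ℝ => d2 B (x1 + t • x2) (x2 + t • x3)) 0 :=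
      (hasDerivAt_d2 hB hx hy).continuousAt
    filter_upwards [c2.eventually (lt_mem_nhds (by simpa using h2))] with t k2
    simp only [momentumOne, bf_smul_right, bf_sub_right, bf_momentumZero_left hB α _ k2,
      bf_momentumZero_mid hB α _ k2, mul_zero, sub_zero]
  have hsum := horth.unique ((hasDerivAt_const (0 : ℝ) (0 : ℝ)).congr_of_eventuallyEq hzero)
  simp only [zero_smul, add_zero, bf_smul_right, bf_sub_right, bf_momentumZero_left hB α x3 h2,
    bf_momentumZero_mid hB α x3 h2, bf_momentumZero_right hB α x3 h2, ← hv] at hsum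
  unfold ELc
  rw [hev.fderiv_eq, hD, fderiv_Lc hB α h1 h2]
  have hs := Real.sqrt_pos.2 h2
  have hss := Real.sq_sqrt h2.le
  simp only [bf_zero_right, add_zero, mul_zero, sub_zero, zero_div, zero_sub]
  have hval : α / Real.sqrt (d2 B x1 x2) *
      (-α / Real.sqrt (d2 B x1 x2) * (d3 B x1 x2 x3 / d2 B x1 x2))
        = -(α ^ 2 * d3 B x1 x2 x3 / d2 B x1 x2 ^ 2) := by
    set s := Real.sqrt (d2 B x1 x2)
    rw [← hss]
    field_simp
  linarith

/-- the primary Lagrangian constraint.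
For the curvature Lagrangian, `⟨[L], p̂¹⟩ + (p̂⁰ p̂⁰) = 0` identically where
`δ₁ > 0` and `δ₂ > 0`; equivalently `⟨[L], p̂¹⟩ = −α² δ₃/δ₂²`. -/
theorem curvature_EL_contracted_with_p1hat
    (d : ℕ) (hd : 3 ≤ d) (B : Matrix (Fin d) (Fin d) ℝ)
    (hBsymm : B.IsSymm) (hBnd : IsUnit B.det)
    (α : ℝ) (hα : α ≠ 0)
    (x0 x1 x2 x3 x4 : V d) (h1 : 0 < d1 B x1) (h2 : 0 < d2 B x1 x2) :
    ELc B α x0 x1 x2 x3 x4 (p1h B α x0 x1 x2) +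
        bf B (p0h B α x0 x1 x2 x3) (p0h B α x0 x1 x2 x3) = 0 ∧
    ELc B α x0 x1 x2 x3 x4 (p1h B α x0 x1 x2) =
        -(α^2 * d3 B x1 x2 x3 / (d2 B x1 x2)^2) := by
  have h := ELc_p1h hBsymm hBnd α (x0 := x0) x3 x4 h1 h2
  refine ⟨?_, h⟩
  rw [h, p0h_eq hBsymm hBnd α h1 h2, bf_momentumZero_self hBsymm α x3 h2]
  ring

end
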